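/- Let d be a positive integer and let J ⊊ I be squarefree monomial ideals of S such that I is generated by squarefree monomials of degrees ≥ d and J is either 0 or generated by squarefree monomials of degrees ≥ d+1. Then depth_S I/J ≥ d. -/

import Mathlib

open MvPolynomial

/-- The squarefree monomial `∏_{i ∈ T} x_i` in `K[x_1,…,x_n]`. -/
noncomputable def sqm (K : Type*) [Field K] {n : ℕ} (T : Finset (Fin n)) :
    MvPolynomial (Fin n) K := ∏ i ∈ T, X i

/-- The poset `P_{I \ J}` of (supports of) squarefree monomials of `I \ J`. -/
def sqPoset {K : Type*} [Field K] {n : ℕ} (I J : Ideal (MvPolynomial (Fin n) K)) :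
    Set (Finset (Fin n)) :=
  {T | sqm K T ∈ I ∧ sqm K T ∉ J}

/-- The squarefree monomials of degree `k` in `I \ J`. -/
def degSet {K : Type*} [Field K] {n : ℕ} (I J : Ideal (MvPolynomial (Fin n) K)) (k : ℕ) :
    Set (Finset (Fin n)) :=
  {T ∈ sqPoset I J | T.card = k}

/-- A partition of `P_{I\J}` into intervals `[u,v]`, recorded as a finite set of
pairs `(u, v)`: each monomial of `P_{I\J}` lies in exactly one interval. -/
def IsIntervalPartition {K : Type*} [Field K] {n : ℕ}
    (I J : Ideal (MvPolynomial (Fin n) K))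
    (F : Finset (Finset (Fin n) × Finset (Fin n))) : Prop :=
  (∀ p ∈ F, p.1 ∈ sqPoset I J ∧ p.2 ∈ sqPoset I J ∧ p.1 ⊆ p.2) ∧
  (∀ T ∈ sqPoset I J, ∃! p, p ∈ F ∧ p.1 ⊆ T ∧ T ⊆ p.2)

/-- The Stanley depth of `I/J`: the maximum over interval partitions of the
minimal degree of an upper endpoint. -/
noncomputable def sdepth {K : Type*} [Field K] {n : ℕ}
    (I J : Ideal (MvPolynomial (Fin n) K)) : ℕ :=
  sSup {k | ∃ F, IsIntervalPartition I J F ∧ ∀ p ∈ F, k ≤ p.2.card}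

/-- The depth of a module over `K[x_1,…,x_n]` with respect to the maximal ideal
`(x_1,…,x_n)`: the supremum of lengths of regular sequences from `(x_1,…,x_n)`. -/
noncomputable def mdepth {K : Type*} [Field K] {n : ℕ}
    (M : Type*) [AddCommGroup M] [Module (MvPolynomial (Fin n) K) M] : ℕ :=
  sSup {k | ∃ rs : List (MvPolynomial (Fin n) K), rs.length = k ∧
    (∀ r ∈ rs, r ∈ Ideal.span (Set.range X : Set (MvPolynomial (Fin n) K))) ∧
    RingTheory.Sequence.IsRegular M rs}

/-- The `S`-module `I/J` (more precisely `I/(J ∩ I)`). -/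
abbrev quotMod {K : Type*} [Field K] {n : ℕ} (I J : Ideal (MvPolynomial (Fin n) K)) :=
  I ⧸ (Submodule.comap I.subtype J)

/-- `depth_S I/J`. -/
noncomputable def depthIJ {K : Type*} [Field K] {n : ℕ}
    (I J : Ideal (MvPolynomial (Fin n) K)) : ℕ :=
  mdepth (K := K) (n := n) (quotMod I J)

/-- An ideal is a squarefree monomial ideal generated in degrees `≥ d` if it is
the span of squarefree monomials whose supports have at least `d` elements. -/
def SqfreeGenFrom {K : Type*} [Field K] {n : ℕ}
    (L : Ideal (MvPolynomial (Fin n) K)) (d : ℕ) : Prop :=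
  ∃ G : Set (Finset (Fin n)), (∀ T ∈ G, d ≤ T.card) ∧ L = Ideal.span (sqm K '' G)

/-- A squarefree monomial ideal. -/
def IsSqfreeMonomialIdeal {K : Type*} [Field K] {n : ℕ}
    (L : Ideal (MvPolynomial (Fin n) K)) : Prop :=
  ∃ G : Set (Finset (Fin n)), L = Ideal.span (sqm K '' G)

open CategoryTheory Abelian RingTheory.Sequence Pointwise

universe u

/-- A regular sequence on a finite module is no longer than the dimension of its support. -/
lemma length_le_supportDim_of_isRegular {R M : Type*} [CommRing R] [AddCommGroup M] [Module R M]
    [Module.Finite R M] (rs : List R) (reg : IsRegular M rs) :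
    (rs.length : WithBot ℕ∞) ≤ Module.supportDim R M := by
  induction rs generalizing M with
  | nil =>
    have := reg.nontrivial
    have h := (Module.supportDim_ne_bot_iff_nontrivial R M).mpr this
    rw [← WithBot.coe_unbot _ h]
    exact WithBot.coe_le_coe.mpr zero_le
  | cons r rs ih =>
    rw [isRegular_cons_iff] at reg
    refine le_trans ?_ (Module.supportDim_quotSMulTop_succ_le_of_notMem_minimalPrimes
      (fun _ ↦ reg.1.notMem_of_mem_minimalPrimes))
    rw [List.length_cons, Nat.cast_succ]
    gcongr
    exact ih reg.2

namespace Ideal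

variable {R : Type u} [CommRing R]

/-- The grade of `𝔪` on `M` is at least `d`, in terms of the vanishing of `Ext`. -/
def ExtVanishing (𝔪 : Ideal R) (M : Type u) [AddCommGroup M] [Module R M] (d : ℕ) : Prop :=
  ∀ i < d, Subsingleton (Ext (ModuleCat.of R (R ⧸ 𝔪)) (ModuleCat.of R M) i)

lemma shortExact_inclusion_mkQ {I J : Ideal R} (h : J ≤ I) :
    (ModuleCat.shortComplexOfCompEqZero (Submodule.inclusion h)
      (Submodule.comap I.subtype J).mkQ (by ext x; simp)).ShortExact := by
  refine ModuleCat.shortComplex_shortExact _ ?_ ?_ ?_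
  · intro x
    simp only [ModuleCat.hom_ofHom, Submodule.mkQ_apply, Submodule.Quotient.mk_eq_zero]
    exact ⟨fun hx ↦ ⟨⟨x.1, hx⟩, rfl⟩, by rintro ⟨a, rfl⟩; exact a.2⟩
  · exact Submodule.inclusion_injective h
  · exact Submodule.mkQ_surjective _

variable {𝔪 : Ideal R}

lemma ExtVanishing.of_subsingleton {M : Type u} [AddCommGroup M] [Module R M] [Subsingleton M]
    (d : ℕ) : 𝔪.ExtVanishing M d := by
  intro i _
  have hM := ModuleCat.isZero_of_subsingleton (ModuleCat.of R M)
  refine subsingleton_of_forall_eq 0 fun e ↦ ?_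
  rw [← e.comp_mk₀_id, hM.eq_zero_of_tgt (𝟙 _), Ext.mk₀_zero, Ext.comp_zero]

lemma ExtVanishing.of_quotient {I J : Ideal R} {d : ℕ} (h : J ≤ I) (hJ : 𝔪.ExtVanishing J d)
    (hQ : 𝔪.ExtVanishing (I ⧸ Submodule.comap I.subtype J) d) : 𝔪.ExtVanishing I d := by
  intro i hi
  refine subsingleton_of_forall_eq 0 fun e ↦ ?_
  obtain ⟨y, rfl⟩ := Ext.covariant_sequence_exact₂ (ModuleCat.of R (R ⧸ 𝔪))
    (shortExact_inclusion_mkQ h) e ((hQ i hi).elim _ _)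
  rw [(hJ i hi).elim y 0, Ext.zero_comp]

lemma ExtVanishing.quotient {I J : Ideal R} {d : ℕ} (h : J ≤ I) (hI : 𝔪.ExtVanishing I d)
    (hJ : 𝔪.ExtVanishing J (d + 1)) :
    𝔪.ExtVanishing (I ⧸ Submodule.comap I.subtype J) d := by
  intro i hi
  refine subsingleton_of_forall_eq 0 fun e ↦ ?_
  obtain ⟨y, rfl⟩ := Ext.covariant_sequence_exact₃ (ModuleCat.of R (R ⧸ 𝔪))
    (shortExact_inclusion_mkQ h) e rfl ((hJ (i + 1) (by omega)).elim _ _)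
  rw [(hI i hi).elim y 0, Ext.zero_comp]

lemma support_quotient_eq_zeroLocus (𝔪 : Ideal R) :
    Module.support R (R ⧸ 𝔪) = PrimeSpectrum.zeroLocus 𝔪 := by
  rw [Module.support_eq_zeroLocus, annihilator_quotient]

lemma ExtVanishing.of_isWeaklyRegular [IsNoetherianRing R] {M : Type u} [AddCommGroup M]
    [Module R M] [Module.Finite R M] (hM : 𝔪 • (⊤ : Submodule R M) < ⊤) {rs : List R}
    (mem : ∀ r ∈ rs, r ∈ 𝔪) (reg : IsWeaklyRegular M rs) : 𝔪.ExtVanishing M rs.length := by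
  refine ModuleCat.subsingleton_ext_of_exists_isRegular 𝔪 (ModuleCat.of R (R ⧸ 𝔪))
    (support_quotient_eq_zeroLocus 𝔪).subset (ModuleCat.of R M) hM rs mem ⟨reg, fun h ↦ hM.ne ?_⟩
  refine top_le_iff.mp (h.le.trans (Submodule.smul_mono_left ?_))
  exact span_le.mpr mem

lemma ExtVanishing.exists_isRegular [IsNoetherianRing R] {M : Type u} [AddCommGroup M]
    [Module R M] [Module.Finite R M] (hM : 𝔪 • (⊤ : Submodule R M) < ⊤) {d : ℕ}
    (h : 𝔪.ExtVanishing M d) :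
    ∃ rs : List R, rs.length = d ∧ (∀ r ∈ rs, r ∈ 𝔪) ∧ IsRegular M rs :=
  ModuleCat.exists_isRegular_of_exists_subsingleton_ext 𝔪 d (ModuleCat.of R M) hM
    (ModuleCat.of R (R ⧸ 𝔪)) (support_quotient_eq_zeroLocus 𝔪) h

end Ideal

section Squarefree

variable {K : Type u} [Field K] {n : ℕ}

lemma sqm_eq_monomial (T : Finset (Fin n)) :
    sqm K T = monomial (∑ i ∈ T, Finsupp.single i 1) 1 := by
  simp [sqm, monomial_sum_one, X]

lemma sum_single_one_le_iff (T : Finset (Fin n)) (m : Fin n →₀ ℕ) :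
    ∑ i ∈ T, Finsupp.single i 1 ≤ m ↔ T ⊆ m.support := by
  simp only [Finsupp.le_def, Finsupp.coe_finsetSum, Finset.sum_apply, Finsupp.single_apply,
    Finset.sum_ite_eq', Finset.subset_iff, Finsupp.mem_support_iff]
  exact forall_congr' fun i ↦ by split_ifs <;> simp [*, Nat.one_le_iff_ne_zero]

lemma mem_span_sqm_iff {G : Set (Finset (Fin n))} {p : MvPolynomial (Fin n) K} :
    p ∈ Ideal.span (sqm K '' G) ↔ ∀ m ∈ p.support, ∃ T ∈ G, T ⊆ m.support := by
  have : sqm K '' G = (fun s ↦ monomial s (1 : K)) ''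
      ((fun T : Finset (Fin n) ↦ ∑ i ∈ T, Finsupp.single i 1) '' G) := by
    rw [Set.image_image]
    exact Set.image_congr fun T _ ↦ sqm_eq_monomial T
  rw [this, mem_ideal_span_monomial_image]
  simp [sum_single_one_le_iff]

lemma support_sum_single_one (T : Finset (Fin n)) :
    (∑ i ∈ T, Finsupp.single i 1 : Fin n →₀ ℕ).support = T := by
  ext i
  simp [Finsupp.single_apply]

lemma sqm_mem_span_sqm_iff {G : Set (Finset (Fin n))} {T : Finset (Fin n)} :
    sqm K T ∈ Ideal.span (sqm K '' G) ↔ ∃ U ∈ G, U ⊆ T := by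
  rw [mem_span_sqm_iff, sqm_eq_monomial]
  simp [support_sum_single_one]

lemma coeff_mul_sqm (p : MvPolynomial (Fin n) K) (T : Finset (Fin n)) (m : Fin n →₀ ℕ) :
    coeff (m + ∑ i ∈ T, Finsupp.single i 1) (p * sqm K T) = coeff m p := by
  rw [sqm_eq_monomial, coeff_mul_monomial, mul_one]

lemma span_sqm_upperClosure (G : Set (Finset (Fin n))) :
    Ideal.span (sqm K '' upperClosure G) = Ideal.span (sqm K '' G) := by
  refine le_antisymm (Ideal.span_le.mpr ?_) (Ideal.span_mono (Set.image_mono subset_upperClosure))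
  rintro _ ⟨T, ⟨U, hU, hUT⟩, rfl⟩
  exact sqm_mem_span_sqm_iff.mpr ⟨U, hU, hUT⟩

lemma idealOfVars_smul_top_lt {G H : Set (Finset (Fin n))}
    (hlt : Ideal.span (sqm K '' H) < Ideal.span (sqm K '' G)) :
    idealOfVars (Fin n) K • (⊤ : Submodule (MvPolynomial (Fin n) K)
      (quotMod (Ideal.span (sqm K '' G)) (Ideal.span (sqm K '' H)))) < ⊤ := by
  refine lt_top_iff_ne_top.mpr fun htop ↦ ?_
  obtain ⟨r, hr, hr0⟩ := Submodule.exists_sub_one_mem_and_smul_eq_zero_of_fg_of_le_smul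
    (idealOfVars (Fin n) K) ⊤ Module.Finite.fg_top htop.ge
  refine hlt.not_ge (Ideal.span_le.mpr ?_)
  rintro _ ⟨T, hT, rfl⟩
  have hT' : sqm K T ∈ Ideal.span (sqm K '' G) := Ideal.subset_span ⟨T, hT, rfl⟩
  have hmem : r * sqm K T ∈ Ideal.span (sqm K '' H) := by
    have := hr0 (Submodule.Quotient.mk ⟨sqm K T, hT'⟩) trivial
    rwa [← Submodule.Quotient.mk_smul, Submodule.Quotient.mk_eq_zero] at this
  have hcoeff : coeff 0 r = 1 := by
    have : constantCoeff (r - 1) = 0 := by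
      refine (Ideal.span_le (I := RingHom.ker (constantCoeff (R := K) (σ := Fin n)))).mpr ?_ hr
      rintro _ ⟨i, rfl⟩
      simp
    simpa [sub_eq_zero, constantCoeff_eq] using this
  obtain ⟨U, hU, hUT⟩ := mem_span_sqm_iff.mp hmem (0 + ∑ i ∈ T, Finsupp.single i 1) <| by
    rw [mem_support_iff, coeff_mul_sqm, hcoeff]
    exact one_ne_zero
  rw [zero_add, support_sum_single_one] at hUT
  exact sqm_mem_span_sqm_iff.mpr ⟨U, hU, hUT⟩

lemma isWeaklyRegular_map_X (l : List (Fin n)) (hl : l.Nodup) :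
    IsWeaklyRegular (MvPolynomial (Fin n) K) (l.map (X (R := K))) := by
  refine ⟨fun k hk ↦ ?_⟩
  rw [List.length_map] at hk
  have hspan : Ideal.ofList ((l.map (X (R := K))).take k) • (⊤ : Ideal (MvPolynomial (Fin n) K)) =
      Ideal.span (X (R := K) '' {i | i ∈ l.take k}) := by
    rw [smul_eq_mul, Ideal.mul_top, Ideal.ofList]
    congr 1
    ext p
    simp [← List.map_take]
  rw [hspan, isSMulRegular_iff_right_eq_zero_of_smul]
  intro p
  induction p using Submodule.Quotient.induction_on with | _ p
  rw [← Submodule.Quotient.mk_smul, Submodule.Quotient.mk_eq_zero, Submodule.Quotient.mk_eq_zero,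
    mem_ideal_span_X_image, mem_ideal_span_X_image]
  intro h m hm
  obtain ⟨i, hi, him⟩ := h (m + Finsupp.single l[k] 1) <| by
    rw [mem_support_iff, List.getElem_map, smul_eq_mul, mul_comm, coeff_mul_X]
    exact mem_support_iff.mp hm
  refine ⟨i, hi, ?_⟩
  have hne : l[k] ≠ i := by
    rintro rfl
    obtain ⟨j, hj, hjk⟩ := List.mem_take_iff_getElem.mp hi
    have := (List.Nodup.getElem_inj_iff hl).mp hjk
    omega
  simpa [Finsupp.single_apply, hne] using him

lemma isWeaklyRegular_quotient_span_X_compl (T : Finset (Fin n)) :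
    IsWeaklyRegular (MvPolynomial (Fin n) K ⧸ Ideal.span (X (R := K) '' {i | i ∉ T}))
      (T.toList.map (X (R := K))) := by
  have h := isWeaklyRegular_map_X (K := K) (Tᶜ.toList ++ T.toList) <| by
    refine List.nodup_append.mpr ⟨Tᶜ.nodup_toList, T.nodup_toList, ?_⟩
    rintro a ha b hb rfl
    simp_all
  rw [List.map_append, isWeaklyRegular_append_iff] at h
  have hspan : Ideal.ofList (Tᶜ.toList.map (X (R := K))) • (⊤ : Ideal (MvPolynomial (Fin n) K)) =
      Ideal.span (X (R := K) '' {i | i ∉ T}) := by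
    rw [smul_eq_mul, Ideal.mul_top, Ideal.ofList]
    congr 1
    ext p
    simp
  rw [hspan] at h
  exact h.2

lemma mul_sqm_mem_span_sqm_diff_iff {G : Set (Finset (Fin n))} (hG : IsUpperSet G)
    {T : Finset (Fin n)} (hT : Minimal (· ∈ G) T) {p : MvPolynomial (Fin n) K} :
    p * sqm K T ∈ Ideal.span (sqm K '' (G \ {T})) ↔ p ∈ Ideal.span (X '' {i | i ∉ T}) := by
  constructor
  · intro h
    rw [mem_ideal_span_X_image]
    intro m hm
    obtain ⟨U, ⟨hU, hUT⟩, hUm⟩ := mem_span_sqm_iff.mp h (m + ∑ i ∈ T, Finsupp.single i 1) <| by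
      rw [mem_support_iff, coeff_mul_sqm]
      exact mem_support_iff.mp hm
    have hnot : ¬ U ⊆ T := fun hle ↦ hUT (hle.antisymm (hT.2 hU hle))
    obtain ⟨i, hiU, hiT⟩ := Finset.not_subset.mp hnot
    refine ⟨i, hiT, ?_⟩
    simpa [Finsupp.single_apply, hiT] using hUm hiU
  · intro h
    refine (Ideal.span_le (I := Submodule.comap (LinearMap.toSpanSingleton _ _ (sqm K T))
      (Ideal.span (sqm K '' (G \ {T}))))).mpr ?_ h
    rintro _ ⟨i, hi, rfl⟩
    have hXi : X i * sqm K T = sqm K (insert i T) := (Finset.prod_insert hi).symm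
    rw [SetLike.mem_coe, Submodule.mem_comap, LinearMap.toSpanSingleton_apply,
      smul_eq_mul, hXi]
    refine Ideal.subset_span ⟨_, ⟨hG (Finset.subset_insert i T) hT.prop, ?_⟩, rfl⟩
    exact fun h ↦ hi (Finset.insert_eq_self.mp h)

/-- Adding a minimal generator `x_T` contributes a copy of the polynomial ring in the variables of
`T`. -/
lemma exists_quotient_span_X_equiv {G : Set (Finset (Fin n))} (hG : IsUpperSet G)
    {T : Finset (Fin n)} (hT : Minimal (· ∈ G) T) :
    Nonempty ((MvPolynomial (Fin n) K ⧸ Ideal.span (X (R := K) '' {i | i ∉ T}))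
      ≃ₗ[MvPolynomial (Fin n) K]
      quotMod (Ideal.span (sqm K '' G)) (Ideal.span (sqm K '' (G \ {T})))) := by
  have hTmem : sqm K T ∈ Ideal.span (sqm K '' G) := Ideal.subset_span ⟨T, hT.prop, rfl⟩
  let f := (Submodule.mkQ (Submodule.comap (Ideal.span (sqm K '' G)).subtype
    (Ideal.span (sqm K '' (G \ {T}))))).comp (LinearMap.toSpanSingleton _ _ ⟨sqm K T, hTmem⟩)
  have hker : LinearMap.ker f = Ideal.span (X '' {i | i ∉ T}) := by
    ext p
    rw [← mul_sqm_mem_span_sqm_diff_iff hG hT]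
    simp [f]
  have hsurj : Function.Surjective f := by
    intro q
    induction q using Submodule.Quotient.induction_on with | _ q
    obtain ⟨q, hq⟩ := q
    have hsup : q ∈ Ideal.span {sqm K T} ⊔ Ideal.span (sqm K '' (G \ {T})) := by
      rw [← Ideal.span_union, ← Set.image_singleton, ← Set.image_union, Set.union_sdiff_cancel]
      · exact hq
      · exact Set.singleton_subset_iff.mpr hT.prop
    obtain ⟨a, ha, b, hb, rfl⟩ := Submodule.mem_sup.mp hsup
    obtain ⟨c, rfl⟩ := Ideal.mem_span_singleton'.mp ha
    refine ⟨c, ?_⟩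
    refine (Submodule.Quotient.eq _).mpr ?_
    simpa using hb
  exact ⟨(Submodule.quotEquivOfEq _ _ hker.symm).trans (f.quotKerEquivOfSurjective hsurj)⟩

lemma extVanishing_span_sqm (G : Set (Finset (Fin n))) (hG : IsUpperSet G) (d : ℕ)
    (hd : ∀ T ∈ G, d ≤ T.card) :
    (idealOfVars (Fin n) K).ExtVanishing (Ideal.span (sqm K '' G)) d := by
  induction hc : G.ncard generalizing G with
  | zero =>
    obtain rfl := (Set.ncard_eq_zero G.toFinite).mp hc
    rw [Set.image_empty, Ideal.span_empty]
    exact .of_subsingleton d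
  | succ c ih =>
    obtain ⟨T, hT⟩ := G.toFinite.exists_minimal
      (Set.nonempty_of_ncard_ne_zero (hc.trans_ne c.succ_ne_zero))
    have hlt : Ideal.span (sqm K '' (G \ {T})) < Ideal.span (sqm K '' G) := by
      refine lt_of_le_not_ge (Ideal.span_mono (Set.image_mono Set.sdiff_subset)) fun hle ↦ ?_
      obtain ⟨U, ⟨hU, hne⟩, hUT⟩ :=
        sqm_mem_span_sqm_iff.mp (hle (Ideal.subset_span ⟨T, hT.prop, rfl⟩))
      exact hne (hUT.antisymm (hT.2 hU hUT))
    refine .of_quotient hlt.le (ih _ ?_ (fun U hU ↦ hd U hU.1) ?_) ?_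
    · exact fun U V hUV hU ↦ ⟨hG hUV hU.1, fun hV ↦ hU.2 <|
        hV.le.trans' hUV |>.antisymm <| hT.2 hU.1 (hV.le.trans' hUV)⟩
    · rw [Set.ncard_sdiff_singleton_of_mem hT.prop, hc, Nat.add_sub_cancel]
    · obtain ⟨e⟩ := exists_quotient_span_X_equiv (K := K) hG hT
      have hreg := (e.isWeaklyRegular_congr _).mp (isWeaklyRegular_quotient_span_X_compl T)
      have hvan := Ideal.ExtVanishing.of_isWeaklyRegular (idealOfVars_smul_top_lt hlt)
        (fun r hr ↦ by
          obtain ⟨i, -, rfl⟩ := List.mem_map.mp hr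
          exact Ideal.subset_span ⟨i, rfl⟩) hreg
      rw [List.length_map, Finset.length_toList] at hvan
      exact fun i hi ↦ hvan i (hi.trans_le (hd T hT.prop))

lemma extVanishing_of_sqfreeGenFrom {I : Ideal (MvPolynomial (Fin n) K)} {d : ℕ}
    (hI : SqfreeGenFrom I d) : (idealOfVars (Fin n) K).ExtVanishing I d := by
  obtain ⟨G, hd, rfl⟩ := hI
  rw [← span_sqm_upperClosure]
  refine extVanishing_span_sqm _ (upperClosure G).upper d ?_
  rintro T ⟨U, hU, hUT⟩
  exact (hd U hU).trans (Finset.card_le_card hUT)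

lemma bddAbove_regularSequence_length (M : Type*) [AddCommGroup M]
    [Module (MvPolynomial (Fin n) K) M] [Module.Finite (MvPolynomial (Fin n) K) M] :
    BddAbove {k | ∃ rs : List (MvPolynomial (Fin n) K), rs.length = k ∧
      (∀ r ∈ rs, r ∈ Ideal.span (Set.range X : Set (MvPolynomial (Fin n) K))) ∧
      IsRegular M rs} := by
  refine ⟨n, ?_⟩
  rintro _ ⟨rs, rfl, -, hrs⟩
  have h := (length_le_supportDim_of_isRegular rs hrs).trans
    (Module.supportDim_le_ringKrullDim _ M)
  rw [MvPolynomial.ringKrullDim_of_isNoetherianRing, ringKrullDim_eq_zero_of_field, zero_add,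
    Nat.card_eq_fintype_card, Fintype.card_fin] at h
  exact_mod_cast h

end Squarefree

/-- `depth I/J ≥ d`. -/
theorem statement14 {K : Type*} [Field K] {n : ℕ} (d : ℕ) (hd : 0 < d)
    (I J : Ideal (MvPolynomial (Fin n) K)) (hJI : J < I)
    (hI : SqfreeGenFrom I d) (hJ : SqfreeGenFrom J (d + 1)) :
    d ≤ depthIJ I J := by
  have hvan := (extVanishing_of_sqfreeGenFrom hI).quotient hJI.le
    (extVanishing_of_sqfreeGenFrom hJ)
  obtain ⟨G, -, rfl⟩ := hI
  obtain ⟨H, -, rfl⟩ := hJ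
  exact le_csSup (bddAbove_regularSequence_length _)
    (hvan.exists_isRegular (idealOfVars_smul_top_lt hJI))
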